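/- Assume MFCQ holds at every x ∈ ℝ^n, the convexity assumption holds, and 0 ≤ α < μ. Then for every x ∈ ℝ^n: d(x) ≤ f*_{I_x} − ((μ − α)/2) |x − x*_{I_x}|² for any minimizer x*_{I_x} of the restricted problem with index set I_x, and d(x) ≤ f* − ((μ − α)/2) |x − x*|². Moreover, d(x) = f* if and only if x = x*. -/

import Mathlib

open scoped RealInnerProductSpace
open Filter

section GradientInequalities

variable {E : Type*} [NormedAddCommGroup E] [InnerProductSpace ℝ E] [CompleteSpace E]

theorem HasGradientAt.hasDerivAt_comp_line {φ : E → ℝ} {G x : E} (hφ : HasGradientAt φ G x)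
    (v : E) : HasDerivAt (fun t : ℝ => φ (x + t • v)) ⟪G, v⟫ 0 := by
  have hφ' : HasGradientAt φ G (x + (0 : ℝ) • v) := by simpa using hφ
  have hline : HasDerivAt (fun t : ℝ => x + t • v) v 0 := by
    simpa using ((hasDerivAt_id (0 : ℝ)).smul_const v).const_add x
  simpa [Function.comp_def] using hφ'.hasFDerivAt.comp_hasDerivAt (0 : ℝ) hline

theorem HasGradientAt.eventually_lt_of_inner_pos {φ : E → ℝ} {G x v : E}
    (hφ : HasGradientAt φ G x) (hv : 0 < ⟪G, v⟫) :
    ∀ᶠ t : ℝ in nhdsWithin 0 (Set.Ioi 0), φ x < φ (x + t • v) := by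
  have hlim := (hφ.hasDerivAt_comp_line v).tendsto_slope_zero_right
  filter_upwards [hlim.eventually (lt_mem_nhds hv), self_mem_nhdsWithin] with t ht ht0
  have ht0 : 0 < t := ht0
  simp only [zero_add, zero_smul, add_zero, smul_eq_mul] at ht
  have := pos_of_mul_pos_right ht (inv_pos.2 ht0).le
  linarith

theorem StrongConvexOn.le_of_hasGradientAt {φ : E → ℝ} {m : ℝ} {G x : E}
    (hc : StrongConvexOn Set.univ m φ) (hφ : HasGradientAt φ G x) (z : E) :
    φ x + ⟪G, z - x⟫ + m / 2 * ‖z - x‖ ^ 2 ≤ φ z := by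
  have hlim := (hφ.hasDerivAt_comp_line (z - x)).tendsto_slope_zero_right
  have hbound : Tendsto (fun t : ℝ => φ z - φ x - (1 - t) * (m / 2 * ‖z - x‖ ^ 2))
      (nhdsWithin 0 (Set.Ioi 0)) (nhds (φ z - φ x - (1 - 0) * (m / 2 * ‖z - x‖ ^ 2))) :=
    ((by fun_prop : Continuous fun t : ℝ =>
      φ z - φ x - (1 - t) * (m / 2 * ‖z - x‖ ^ 2)).tendsto 0).mono_left nhdsWithin_le_nhds
  have hle := le_of_tendsto_of_tendsto hlim hbound (by
    filter_upwards [Ioo_mem_nhdsGT (zero_lt_one : (0 : ℝ) < 1)] with t ht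
    have hconv := hc.2 (Set.mem_univ x) (Set.mem_univ z) (sub_nonneg.2 ht.2.le) ht.1.le
      (by ring)
    have hpt : (1 - t) • x + t • z = x + t • (z - x) := by module
    rw [hpt, norm_sub_rev x z] at hconv
    simp only [zero_add, zero_smul, add_zero, smul_eq_mul] at hconv ⊢
    rw [inv_mul_le_iff₀ ht.1]
    linarith)
  linarith

theorem ConvexOn.le_of_hasGradientAt {φ : E → ℝ} {G x : E}
    (hc : ConvexOn ℝ Set.univ φ) (hφ : HasGradientAt φ G x) (z : E) :
    φ x + ⟪G, z - x⟫ ≤ φ z := by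
  simpa using (strongConvexOn_zero.2 hc).le_of_hasGradientAt hφ z

theorem ConcaveOn.le_of_hasGradientAt {φ : E → ℝ} {G x : E}
    (hc : ConcaveOn ℝ Set.univ φ) (hφ : HasGradientAt φ G x) (z : E) :
    φ z ≤ φ x + ⟪G, z - x⟫ := by
  have := ConvexOn.le_of_hasGradientAt hc.neg
    (G := -G) (x := x) (by
      rw [hasGradientAt_iff_hasFDerivAt, map_neg]
      exact hφ.hasFDerivAt.neg) z
  simp only [Pi.neg_apply, inner_neg_left] at this
  linarith

end GradientInequalities

theorem inner_nonpos_of_forall_norm_le {E : Type*} [NormedAddCommGroup E]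
    [InnerProductSpace ℝ E] {r q : E}
    (hmin : ∀ t : ℝ, 0 < t → t ≤ 1 → ‖r‖ ^ 2 ≤ ‖r - t • q‖ ^ 2) : ⟪r, q⟫ ≤ 0 := by
  by_contra! hpos
  have hq : 0 ≤ ‖q‖ ^ 2 := by positivity
  set t : ℝ := min 1 (⟪r, q⟫ / (‖q‖ ^ 2 + 1)) with htdef
  have ht : 0 < t := lt_min one_pos (by positivity)
  have htq : t * (‖q‖ ^ 2 + 1) ≤ ⟪r, q⟫ :=
    (le_div_iff₀ (by positivity)).1 (min_le_right _ _)
  have := hmin t ht (min_le_left _ _)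
  rw [norm_sub_sq_real, inner_smul_right, norm_smul, mul_pow, Real.norm_eq_abs, sq_abs] at this
  nlinarith

theorem neg_norm_sq_div_le_inner_add {E : Type*} [NormedAddCommGroup E]
    [InnerProductSpace ℝ E] {α : ℝ} (hα : 0 < α) (v w : E) :
    -(1 / (2 * α) * ‖v‖ ^ 2) ≤ ⟪v, w⟫ + α / 2 * ‖w‖ ^ 2 := by
  have hsq : 0 ≤ 1 / (2 * α) * ‖v + α • w‖ ^ 2 := by positivity
  rw [norm_add_sq_real, inner_smul_right, norm_smul, mul_pow, Real.norm_eq_abs, sq_abs] at hsq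
  have : 1 / (2 * α) * (‖v‖ ^ 2 + 2 * (α * ⟪v, w⟫) + α ^ 2 * ‖w‖ ^ 2) =
      1 / (2 * α) * ‖v‖ ^ 2 + ⟪v, w⟫ + α / 2 * ‖w‖ ^ 2 := by
    field_simp
  linarith

/-- under MFCQ everywhere, the convexity assumption, and `0 ≤ α < μ`:
`d(x) ≤ f*_{I_x} − ((μ−α)/2)‖x − x*_{I_x}‖²` for any minimizer `x*_{I_x}` of the restricted
problem with index set `I_x`; `d(x) ≤ f* − ((μ−α)/2)‖x − x*‖²`; and `d(x) = f*` iff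
`x = x*`. -/
theorem stmt13
    {E : Type*} [NormedAddCommGroup E] [InnerProductSpace ℝ E] [FiniteDimensional ℝ E]
    {ng nh : ℕ} (hng : 0 < ng) (hnh : 0 < nh)
    (f : E → ℝ) (g : Fin ng → E → ℝ) (h : Fin nh → E → ℝ)
    (gf : E → E) (gg : Fin ng → E → E) (gh : Fin nh → E → E)
    (hf : ∀ y, HasGradientAt f (gf y) y)
    (hg : ∀ i y, HasGradientAt (g i) (gg i y) y)
    (hh : ∀ j y, HasGradientAt (h j) (gh j y) y)
    (hgfc : Continuous gf) (hggc : ∀ i, Continuous (gg i)) (hghc : ∀ j, Continuous (gh j))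
    -- Lipschitz gradients
    (Lf Lg Lh : ℝ)
    (hgfL : ∀ y z, ‖gf y - gf z‖ ≤ Lf * ‖y - z‖)
    (hggL : ∀ i y z, ‖gg i y - gg i z‖ ≤ Lg * ‖y - z‖)
    (hghL : ∀ j y z, ‖gh j y - gh j z‖ ≤ Lh * ‖y - z‖)
    -- MFCQ at every point
    (mfcq : ∀ x : E, LinearIndependent ℝ (fun j : Fin nh => gh j x) ∧
      ∃ w : E, (∀ j : Fin nh, ⟪gh j x, w⟫ = 0) ∧
        ∀ i : Fin ng, g i x ≤ 0 → 0 < ⟪gg i x, w⟫)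
    -- convexity assumption
    (hhaff : ∀ j, ConvexOn ℝ Set.univ (h j) ∧ ConcaveOn ℝ Set.univ (h j))
    (hgconc : ∀ i, ConcaveOn ℝ Set.univ (g i))
    {μ : ℝ} (hμ : 0 < μ) (hfsc : StrongConvexOn Set.univ μ f)
    (hcoer : Tendsto f (cocompact E) atTop)
    (hCne : {y : E | (∀ i, 0 ≤ g i y) ∧ ∀ j, h j y = 0}.Nonempty)
    (hCbd : Bornology.IsBounded {y : E | (∀ i, 0 ≤ g i y) ∧ ∀ j, h j y = 0})
    (xstar : E) (hxsC : (∀ i, 0 ≤ g i xstar) ∧ ∀ j, h j xstar = 0)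
    (hxsmin : ∀ y : E, ((∀ i, 0 ≤ g i y) ∧ ∀ j, h j y = 0) → f xstar ≤ f y)
    -- parameter range
    {α : ℝ} (hα0 : 0 ≤ α) (hαμ : α < μ)
    -- the maximizer `λ(·) = (lamh ·, lamg ·) ∈ D_x` of the dual, and the dual function `d`
    (lamh : E → Fin nh → ℝ) (lamg : E → Fin ng → ℝ)
    (hlam_nn : ∀ y i, 0 ≤ lamg y i)
    (hlam_supp : ∀ y i, 0 < g i y → lamg y i = 0)
    (dval : E → ℝ)
    (hd_eq : ∀ y : E, dval y =
      (f y - ((∑ j : Fin nh, lamh y j * h j y) + ∑ i : Fin ng, lamg y i * g i y)) -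
        1/(2*α) * ‖gf y - ((∑ j : Fin nh, lamh y j • gh j y) +
          ∑ i : Fin ng, lamg y i • gg i y)‖^2)
    (hd_max : ∀ (y : E) (lh : Fin nh → ℝ) (lg : Fin ng → ℝ),
      (∀ i, 0 ≤ lg i) → (∀ i, 0 < g i y → lg i = 0) →
      (f y - ((∑ j : Fin nh, lh j * h j y) + ∑ i : Fin ng, lg i * g i y)) -
        1/(2*α) * ‖gf y - ((∑ j : Fin nh, lh j • gh j y) +
          ∑ i : Fin ng, lg i • gg i y)‖^2 ≤ dval y)
    :
    (∀ x zI : E,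
      ((∀ j : Fin nh, h j zI = 0) ∧ ∀ i : Fin ng, g i x ≤ 0 → 0 ≤ g i zI) →
      (∀ z : E, ((∀ j : Fin nh, h j z = 0) ∧ ∀ i : Fin ng, g i x ≤ 0 → 0 ≤ g i z) →
        f zI ≤ f z) →
      dval x ≤ f zI - (μ - α)/2 * ‖x - zI‖^2) ∧
    (∀ x : E, dval x ≤ f xstar - (μ - α)/2 * ‖x - xstar‖^2) ∧
    (∀ x : E, dval x = f xstar ↔ x = xstar) := by
  have hαpos : 0 < α := by
    refine hα0.lt_of_ne fun hα => ?_
    subst hα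
    have hvanish : ∀ y j, h j y = 0 := by
      intro y j
      by_contra hne
      have := hd_max y (Pi.single j ((f y - dval y - 1) / h j y))
        0 (by simp) (by simp)
      simp [Pi.single_apply, hne] at this
      linarith
    have hgrad : gh ⟨0, hnh⟩ xstar = 0 := by
      have hzero : h ⟨0, hnh⟩ = fun _ => 0 := funext fun y => hvanish y _
      have := hh ⟨0, hnh⟩ xstar
      rw [hzero] at this
      exact this.unique (hasGradientAt_const xstar (0 : ℝ))
    exact (mfcq xstar).1.ne_zero _ hgrad
  have hbound : ∀ x z : E,
      ((∀ j : Fin nh, h j z = 0) ∧ ∀ i : Fin ng, g i x ≤ 0 → 0 ≤ g i z) →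
      dval x ≤ f z - (μ - α) / 2 * ‖x - z‖ ^ 2 := by
    intro x z hz
    have hfz := hfsc.le_of_hasGradientAt (hf x) z
    have hhz : 0 = ∑ j, lamh x j * (h j x + ⟪gh j x, z - x⟫) := by
      refine (Finset.sum_eq_zero fun j _ => ?_).symm
      have h1 := (hhaff j).1.le_of_hasGradientAt (hh j x) z
      have h2 := (hhaff j).2.le_of_hasGradientAt (hh j x) z
      rw [le_antisymm h1 h2, hz.1 j, mul_zero]
    have hgz : 0 ≤ ∑ i, lamg x i * (g i x + ⟪gg i x, z - x⟫) := by
      refine Finset.sum_nonneg fun i _ => ?_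
      rcases lt_or_ge 0 (g i x) with hi | hi
      · simp [hlam_supp x i hi]
      · exact mul_nonneg (hlam_nn x i)
          ((hz.2 i hi).trans ((hgconc i).le_of_hasGradientAt (hg i x) z))
    have hq := neg_norm_sq_div_le_inner_add hαpos
      (gf x - ((∑ j, lamh x j • gh j x) + ∑ i, lamg x i • gg i x)) (z - x)
    rw [inner_sub_left, inner_add_left, sum_inner, sum_inner] at hq
    simp only [inner_smul_left, RCLike.conj_to_real] at hq
    simp only [mul_add, Finset.sum_add_distrib] at hhz hgz
    rw [hd_eq x, norm_sub_rev x z]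
    linarith
  have hbound_star : ∀ x : E, dval x ≤ f xstar - (μ - α) / 2 * ‖x - xstar‖ ^ 2 :=
    fun x => hbound x xstar ⟨hxsC.2, fun i _ => hxsC.1 i⟩
  refine ⟨fun x zI hzI _ => hbound x zI hzI, hbound_star, fun x => ⟨fun hx => ?_, ?_⟩⟩
  · have hx' := hbound_star x
    rw [hx] at hx'
    have hsq : ‖x - xstar‖ ^ 2 ≤ 0 := by
      by_contra! hlt
      nlinarith [mul_pos (sub_pos.2 hαμ) hlt]
    exact sub_eq_zero.1 (norm_eq_zero.1 (pow_eq_zero_iff two_ne_zero |>.1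
      (le_antisymm hsq (by positivity))))
  rintro rfl
  have hcompl : ∀ lg : Fin ng → ℝ, (∀ i, 0 < g i x → lg i = 0) →
      ∀ i, lg i * g i x = 0 := by
    intro lg hlg i
    rcases (hxsC.1 i).lt_or_eq with hi | hi
    · simp [hlg i hi]
    · simp [← hi]
  have hdx := hd_eq x
  simp only [hxsC.2, mul_zero, hcompl _ (hlam_supp x), Finset.sum_const_zero, add_zero,
    sub_zero] at hdx
  set p : E := (∑ j, lamh x j • gh j x) + ∑ i, lamg x i • gg i x with hp
  set r : E := gf x - p with hr
  have hmin : ∀ (lh : Fin nh → ℝ) (lg : Fin ng → ℝ),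
      (∀ i, 0 ≤ lg i) → (∀ i, 0 < g i x → lg i = 0) →
      ‖r‖ ^ 2 ≤ ‖gf x - ((∑ j, lh j • gh j x) + ∑ i, lg i • gg i x)‖ ^ 2 := by
    intro lh lg hnn hsupp
    have := hd_max x lh lg hnn hsupp
    simp only [hxsC.2, mul_zero, hcompl _ hsupp, Finset.sum_const_zero, add_zero,
      sub_zero, hdx] at this
    exact le_of_mul_le_mul_left (by linarith) (by positivity : 0 < 1 / (2 * α))
  suffices hr0 : r = 0 by rw [hdx, hr0]; simp
  have hrh_le : ∀ (c : ℝ) j, ⟪r, c • gh j x⟫ ≤ 0 := by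
    intro c j
    refine inner_nonpos_of_forall_norm_le fun t _ _ => ?_
    have := hmin (lamh x + Pi.single j (t * c)) (lamg x) (hlam_nn x) (hlam_supp x)
    have hsum : ∑ k, (lamh x + Pi.single j (t * c) : Fin nh → ℝ) k • gh k x =
        (∑ k, lamh x k • gh k x) + t • c • gh j x := by
      simp [add_smul, Finset.sum_add_distrib, Pi.single_apply, mul_smul]
    rw [hsum] at this
    convert this using 3
    rw [hr, hp]; abel
  have hrh : ∀ j, ⟪gh j x, r⟫ = 0 := by
    intro j
    have h1 := hrh_le 1 j
    have h2 := hrh_le (-1) j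
    simp only [one_smul, neg_smul, inner_neg_right] at h1 h2
    rw [real_inner_comm]
    linarith
  have hrg : ∀ i, g i x ≤ 0 → ⟪gg i x, r⟫ ≤ 0 := by
    intro i hi
    rw [real_inner_comm]
    refine inner_nonpos_of_forall_norm_le fun t ht _ => ?_
    have := hmin (lamh x) (lamg x + Pi.single i t)
      (fun k => add_nonneg (hlam_nn x k) (by
        rw [Pi.single_apply]; split_ifs <;> [exact ht.le; exact le_rfl]))
      (fun k hk => by
        have hki : k ≠ i := fun hki => absurd hi (not_le.2 (hki ▸ hk))
        simp [hlam_supp x k hk, hki])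
    have hsum : ∑ k, (lamg x + Pi.single i t : Fin ng → ℝ) k • gg k x =
        (∑ k, lamg x k • gg k x) + t • gg i x := by
      simp [add_smul, Finset.sum_add_distrib, Pi.single_apply]
    rw [hsum] at this
    convert this using 3
    rw [hr, hp]; abel
  have hrp : ⟪r, -p⟫ ≤ 0 := by
    refine inner_nonpos_of_forall_norm_le fun t _ ht1 => ?_
    have := hmin ((1 - t) • lamh x) ((1 - t) • lamg x)
      (fun k => mul_nonneg (sub_nonneg.2 ht1) (hlam_nn x k))
      (fun k hk => by simp [hlam_supp x k hk])
    simp only [Pi.smul_apply, smul_assoc, ← Finset.smul_sum, ← smul_add, ← hp] at this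
    convert this using 3
    rw [hr]; module
  by_contra hne
  have hfr : 0 < ⟪gf x, r⟫ := by
    have hgf : gf x = r + p := by rw [hr]; abel
    rw [inner_neg_right] at hrp
    rw [hgf, inner_add_left, real_inner_self_eq_norm_sq, real_inner_comm]
    have := norm_pos_iff.2 hne
    nlinarith
  obtain ⟨w, hwh, hwg⟩ := (mfcq x).2
  obtain ⟨ε, hε, hεf⟩ : ∃ ε : ℝ, 0 < ε ∧ 0 < ⟪gf x, r - ε • w⟫ := by
    have hcont : Continuous fun ε : ℝ => ⟪gf x, r - ε • w⟫ := by fun_prop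
    have hev : ∀ᶠ ε : ℝ in nhdsWithin 0 (Set.Ioi 0), 0 < ⟪gf x, r - ε • w⟫ :=
      ((hcont.tendsto 0).mono_left nhdsWithin_le_nhds).eventually
        (lt_mem_nhds (by simpa using hfr))
    exact ((eventually_mem_nhdsWithin (s := Set.Ioi (0 : ℝ))).and hev).exists
  set v : E := ε • w - r with hv
  have hvh : ∀ j, ⟪gh j x, v⟫ = 0 := fun j => by
    rw [hv, inner_sub_right, inner_smul_right, hwh j, hrh j]; simp
  have hvg : ∀ i, g i x ≤ 0 → 0 < ⟪gg i x, v⟫ := fun i hi => by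
    rw [hv, inner_sub_right, inner_smul_right]
    linarith [mul_pos hε (hwg i hi), hrg i hi]
  have hfdec : ∀ᶠ t : ℝ in nhdsWithin 0 (Set.Ioi 0), f (x + t • v) < f x := by
    have hneg : HasGradientAt (fun y => -f y) (-gf x) x := by
      rw [hasGradientAt_iff_hasFDerivAt, map_neg]
      exact (hf x).hasFDerivAt.neg
    have hpos : 0 < ⟪-gf x, v⟫ := by
      rw [hv, ← neg_sub r, inner_neg_neg]
      exact hεf
    filter_upwards [hneg.eventually_lt_of_inner_pos hpos] with t ht
    linarith
  have hgfeas : ∀ᶠ t : ℝ in nhdsWithin 0 (Set.Ioi 0), ∀ i, 0 ≤ g i (x + t • v) := by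
    refine eventually_all.2 fun i => ?_
    rcases (hxsC.1 i).lt_or_eq with hi | hi
    · have hcont := (hg i x).hasDerivAt_comp_line v |>.continuousAt
      filter_upwards [(hcont.tendsto.mono_left nhdsWithin_le_nhds).eventually
        (lt_mem_nhds (by simpa using hi))] with t ht
      exact ht.le
    · filter_upwards [(hg i x).eventually_lt_of_inner_pos (hvg i hi.ge)] with t ht
      exact (hxsC.1 i).trans ht.le
  obtain ⟨t, htf, htg⟩ := (hfdec.and hgfeas).exists
  refine absurd (hxsmin (x + t • v) ⟨htg, fun j => ?_⟩) (not_le.2 htf)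
  have h1 := (hhaff j).1.le_of_hasGradientAt (hh j x) (x + t • v)
  have h2 := (hhaff j).2.le_of_hasGradientAt (hh j x) (x + t • v)
  rw [add_sub_cancel_left, inner_smul_right, hvh j, hxsC.2 j] at h1 h2
  linarith
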